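/- ∫_0^1 f(-q^5)^4 · q^{-1/6} dq = (1/(8·2^{1/6})) · π · (√5 − 1)^{25/6} · ₂F₁(5/6, 5/6; 1; (−123 + 55√5)/2). -/

import Mathlib

open MeasureTheory Real
/-- Euler's product `f(-q) = ∏_{n=1}^∞ (1 - qⁿ)`. -/
noncomputable def eulerF (q : ℝ) : ℝ := ∏' n : ℕ, (1 - q ^ (n + 1))

/-- Gauss hypergeometric series `₂F₁(a, b; c; z)`. -/
noncomputable def hyp2F1 (a b c z : ℝ) : ℝ :=
  ∑' n : ℕ, ((ascPochhammer ℝ n).eval a * (ascPochhammer ℝ n).eval b /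
    (ascPochhammer ℝ n).eval c) * z ^ n / n.factorial

section COV
open Set Filter Topology

/-- A solution `Y` on `(0, ∞)` of `Y' = w (Y² + 1728)^(2/3)` that runs from `-∞` to `∞` computes
the integral of `w`, independently of `Y`. -/
lemma integral_Ioi_eq_of_hasDerivAt_sq_add_rpow {Y w : ℝ → ℝ} (hw : ∀ t, 0 < t → 0 < w t)
    (hY : ∀ t, 0 < t → HasDerivAt Y ((Y t ^ 2 + 1728) ^ (2 / 3 : ℝ) * w t) t)
    (htop : Tendsto Y atTop atTop) (hbot : Tendsto Y (𝓝[>] 0) atBot) :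
    ∫ t in Ioi (0 : ℝ), w t = ∫ y : ℝ, (y ^ 2 + 1728) ^ (-(2 / 3) : ℝ) := by
  have hpos : ∀ y : ℝ, 0 < (y ^ 2 + 1728) ^ (2 / 3 : ℝ) := fun y ↦ by positivity
  have hcont : ContinuousOn Y (Ioi 0) := fun t ht ↦ (hY t ht).continuousAt.continuousWithinAt
  have hmono : StrictMonoOn Y (Ioi 0) := by
    refine strictMonoOn_of_deriv_pos (convex_Ioi 0) hcont fun t ht ↦ ?_
    rw [interior_Ioi] at ht
    rw [(hY t ht).deriv]
    exact mul_pos (hpos _) (hw t ht)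
  have himage : Y '' Ioi 0 = univ := by
    refine eq_univ_of_forall fun y ↦ ?_
    obtain ⟨b, hb, hb0⟩ := ((htop.eventually_ge_atTop y).and (eventually_gt_atTop 0)).exists
    obtain ⟨a, ha, ha0⟩ := ((hbot.eventually_le_atBot y).and self_mem_nhdsWithin).exists
    exact isPreconnected_Ioi.intermediate_value ha0 hb0 hcont ⟨ha, hb⟩
  have h := integral_image_eq_integral_abs_deriv_smul measurableSet_Ioi
    (fun t ht ↦ (hY t ht).hasDerivWithinAt) hmono.injOn
    (fun y : ℝ ↦ (y ^ 2 + 1728) ^ (-(2 / 3) : ℝ))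
  rw [himage, setIntegral_univ] at h
  rw [h]
  refine setIntegral_congr_fun measurableSet_Ioi fun t ht ↦ ?_
  have h1 := hpos (Y t)
  simp only [smul_eq_mul]
  rw [abs_of_pos (mul_pos h1 (hw t ht)), rpow_neg (by positivity)]
  field_simp

/-- The algebraic solution of `Y' = (5/2) t^(-5/6) (t² + 22 t + 125)^(-1/2) (Y² + 1728)^(2/3)`. -/
noncomputable def quinticY (t : ℝ) : ℝ := √(t ^ 2 + 22 * t + 125) * (t ^ 2 + 4 * t - 1) / √t

lemma quinticY_sq_add {t : ℝ} (ht : 0 < t) :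
    quinticY t ^ 2 + 1728 = (t ^ 2 + 10 * t + 5) ^ 3 / t := by
  rw [quinticY, div_pow, mul_pow, sq_sqrt (by positivity), sq_sqrt ht.le]
  field_simp
  ring

lemma quinticY_sq_add_rpow {t : ℝ} (ht : 0 < t) :
    (quinticY t ^ 2 + 1728) ^ (2 / 3 : ℝ) = (t ^ 2 + 10 * t + 5) ^ 2 * t ^ (-(2 / 3) : ℝ) := by
  rw [quinticY_sq_add ht, div_eq_mul_inv, mul_rpow (by positivity) (by positivity),
    ← rpow_natCast, ← rpow_mul (by positivity), ← rpow_neg_one, ← rpow_mul ht.le,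
    ← rpow_natCast (t ^ 2 + 10 * t + 5) 2]
  norm_num

lemma hasDerivAt_quinticY {t : ℝ} (ht : 0 < t) :
    HasDerivAt quinticY ((quinticY t ^ 2 + 1728) ^ (2 / 3 : ℝ) *
      (5 / 2 * (t ^ (-(5 / 6) : ℝ) * (√(t ^ 2 + 22 * t + 125))⁻¹))) t := by
  have hP : 0 < t ^ 2 + 22 * t + 125 := by positivity
  have h1 : HasDerivAt (fun t : ℝ ↦ t ^ 2 + 22 * t + 125) (2 * t + 22) t := by
    simpa using (((hasDerivAt_id t).pow 2).add ((hasDerivAt_id t).const_mul 22)).add_const 125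
  have h2 : HasDerivAt (fun t : ℝ ↦ t ^ 2 + 4 * t - 1) (2 * t + 4) t := by
    simpa using (((hasDerivAt_id t).pow 2).add ((hasDerivAt_id t).const_mul 4)).sub_const 1
  have h := ((h1.sqrt hP.ne').mul h2).div (hasDerivAt_sqrt ht.ne') (sqrt_pos.mpr ht).ne'
  refine h.congr_deriv ?_
  rw [quinticY_sq_add_rpow ht]
  have h3 : t ^ (-(2 / 3) : ℝ) * t ^ (-(5 / 6) : ℝ) = (t * √t)⁻¹ := by
    rw [← rpow_add ht, sqrt_eq_rpow]
    nth_rewrite 2 [← rpow_one t]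
    rw [← rpow_add ht, ← rpow_neg ht.le]
    norm_num
  rw [show (t ^ 2 + 10 * t + 5) ^ 2 * t ^ (-(2 / 3) : ℝ) * (5 / 2 * (t ^ (-(5 / 6) : ℝ) *
      (√(t ^ 2 + 22 * t + 125))⁻¹)) = (t ^ 2 + 10 * t + 5) ^ 2 * (5 / 2) *
      (√(t ^ 2 + 22 * t + 125))⁻¹ * (t ^ (-(2 / 3) : ℝ) * t ^ (-(5 / 6) : ℝ)) by ring, h3]
  have hs := sqrt_pos.mpr hP
  have ht' := sqrt_pos.mpr ht
  have e1 := sq_sqrt hP.le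
  have e2 := sq_sqrt ht.le
  simp only [Pi.mul_apply]
  set s := √(t ^ 2 + 22 * t + 125)
  set r := √t
  field_simp
  rw [e1, e2]
  ring

lemma tendsto_quinticY_atTop : Tendsto quinticY atTop atTop := by
  refine tendsto_atTop_mono' atTop ?_ tendsto_id
  filter_upwards [eventually_ge_atTop 1] with t ht
  have ht0 : 0 < t := by linarith
  have h1 : √t ≤ √(t ^ 2 + 22 * t + 125) := sqrt_le_sqrt (by nlinarith)
  rw [quinticY, id, le_div_iff₀ (sqrt_pos.mpr ht0)]
  have h2 := sqrt_nonneg t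
  have h3 : t ≤ t ^ 2 + 4 * t - 1 := by nlinarith
  calc t * √t ≤ (t ^ 2 + 4 * t - 1) * √(t ^ 2 + 22 * t + 125) := by gcongr; nlinarith
    _ = _ := mul_comm _ _

lemma tendsto_quinticY_zero : Tendsto quinticY (𝓝[>] 0) atBot := by
  have h1 : Tendsto (fun t : ℝ ↦ √(t ^ 2 + 22 * t + 125) * (t ^ 2 + 4 * t - 1)) (𝓝[>] 0)
      (𝓝 (-√125)) := by
    have : ContinuousAt (fun t : ℝ ↦ √(t ^ 2 + 22 * t + 125) * (t ^ 2 + 4 * t - 1)) 0 := by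
      fun_prop
    simpa [ContinuousAt] using this.tendsto.mono_left nhdsWithin_le_nhds
  have h2 : Tendsto (fun t : ℝ ↦ (√t)⁻¹) (𝓝[>] 0) atTop := by
    refine tendsto_inv_nhdsGT_zero.comp (tendsto_nhdsWithin_iff.mpr ⟨?_, ?_⟩)
    · simpa using (continuous_sqrt.tendsto 0).mono_left nhdsWithin_le_nhds
    · filter_upwards [self_mem_nhdsWithin] with t ht using sqrt_pos.mpr ht
  exact h1.neg_mul_atTop (by simp) h2

lemma integral_Ioi_quintic :
    ∫ t in Ioi (0 : ℝ), t ^ (-(5 / 6) : ℝ) * (√(t ^ 2 + 22 * t + 125))⁻¹ =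
      2 / 5 * ∫ y : ℝ, (y ^ 2 + 1728) ^ (-(2 / 3) : ℝ) := by
  rw [← integral_Ioi_eq_of_hasDerivAt_sq_add_rpow (fun t ht ↦ by positivity)
    (fun t ht ↦ hasDerivAt_quinticY ht) tendsto_quinticY_atTop tendsto_quinticY_zero,
    integral_const_mul]
  ring

lemma integral_Ioi_quintic_eq_integral_Ioo {a : ℝ} (ha : 0 < a) (ha2 : a ^ 2 + 11 * a = 1) :
    ∫ t in Ioi (0 : ℝ), t ^ (-(5 / 6) : ℝ) * (√(t ^ 2 + 22 * t + 125))⁻¹ =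
      a ^ (5 / 6 : ℝ) * ∫ u in Ioo (0 : ℝ) 1,
        u ^ (-(1 / 6) : ℝ) * (1 - u) ^ (-(5 / 6) : ℝ) * (1 + a ^ 2 * u) ^ (-(5 / 6) : ℝ) := by
  let T : ℝ → ℝ := fun u ↦ a⁻¹ * u⁻¹ - 11 - a * u
  have hT : ∀ u, 0 < u → HasDerivAt T (-(a⁻¹ * (u ^ 2)⁻¹ + a)) u := by
    intro u hu
    have h := (((hasDerivAt_inv hu.ne').const_mul a⁻¹).sub_const 11).sub
      ((hasDerivAt_id u).const_mul a)
    exact h.congr_deriv (by simp; ring)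
  have hfac : ∀ u, 0 < u → T u = (1 - u) * (1 + a ^ 2 * u) * (a * u)⁻¹ := by
    intro u hu
    simp only [T]
    field_simp
    linear_combination -u * ha2
  have hanti : StrictAntiOn T (Ioi 0) := by
    refine strictAntiOn_of_deriv_neg (convex_Ioi 0)
      (fun t ht ↦ (hT t ht).continuousAt.continuousWithinAt) fun t ht ↦ ?_
    rw [interior_Ioi] at ht
    have : 0 < t := ht
    rw [(hT t ht).deriv, neg_lt_zero]
    positivity
  have himage : T '' Ioo 0 1 = Ioi 0 := by
    ext t
    constructor
    · rintro ⟨u, ⟨hu0, hu1⟩, rfl⟩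
      have : 0 < 1 - u := by linarith
      rw [mem_Ioi, hfac u hu0]
      positivity
    · intro ht
      have ht : 0 < t := ht
      have hε : 0 < (a * (t + 12))⁻¹ := by positivity
      have hmem : T 1 < t := by rw [hfac 1 one_pos]; simpa using ht
      obtain ⟨ε, hε0, hε1, hεt⟩ : ∃ ε, 0 < ε ∧ ε < 1 ∧ t < T ε := by
        refine ⟨(1 + a * (t + 12))⁻¹, by positivity, inv_lt_one_of_one_lt₀ (by
          have : 0 < a * (t + 12) := by positivity
          linarith), ?_⟩
        have h1 : a * (1 + a * (t + 12))⁻¹ < 1 := by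
          rw [← div_eq_mul_inv, div_lt_one (by positivity)]
          nlinarith
        simp only [T, inv_inv]
        have h2 : a⁻¹ * (1 + a * (t + 12)) = a⁻¹ + t + 12 := by field_simp; ring
        have := inv_pos.mpr ha
        linarith
      obtain ⟨u, hu, rfl⟩ := intermediate_value_Ioo' hε1.le (f := T) (fun s hs ↦
        (hT s (hε0.trans_le hs.1)).continuousAt.continuousWithinAt) ⟨hmem, hεt⟩
      exact ⟨u, ⟨hε0.trans hu.1, hu.2⟩, rfl⟩
  have h := integral_image_eq_integral_abs_deriv_smul measurableSet_Ioo
    (fun u hu ↦ (hT u hu.1).hasDerivWithinAt) (hanti.injOn.mono fun u hu ↦ hu.1)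
    (fun t : ℝ ↦ t ^ (-(5 / 6) : ℝ) * (√(t ^ 2 + 22 * t + 125))⁻¹) (s := Ioo 0 1)
  rw [himage] at h
  rw [h, ← integral_const_mul]
  refine setIntegral_congr_fun measurableSet_Ioo fun u ⟨hu0, hu1⟩ ↦ ?_
  have h1u : 0 < 1 - u := by linarith
  have hau : 0 < a * u := by positivity
  have hsq : T u ^ 2 + 22 * T u + 125 = (a⁻¹ * u⁻¹ + a * u) ^ 2 := by
    simp only [T]
    field_simp
    ring
  simp only [smul_eq_mul]
  rw [hsq, sqrt_sq (by positivity), abs_neg, abs_of_pos (by positivity), hfac u hu0,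
    mul_rpow (by positivity) (by positivity), mul_rpow h1u.le (by positivity),
    inv_rpow hau.le, rpow_neg hau.le, inv_inv, mul_rpow ha.le hu0.le]
  have h6 : u ^ (5 / 6 : ℝ) = u * u ^ (-(1 / 6) : ℝ) := by
    nth_rewrite 2 [← rpow_one u]
    rw [← rpow_add hu0]
    norm_num
  rw [h6]
  field_simp

end COV

section Modular
open UpperHalfPlane hiding I
open Complex Filter Topology Function ModularForm EisensteinSeries Derivative
open scoped Manifold MatrixGroups

local notation "𝕢" => Periodic.qParam

/-- A `q`-series on the upper half-plane tends to its constant term at `i∞`. -/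
lemma tendsto_atImInfty_of_hasSum_qParam {f : ℍ → ℂ} {c : ℕ → ℂ}
    (hf : ∀ τ : ℍ, HasSum (fun m ↦ c m • 𝕢 1 τ ^ m) (f τ)) :
    Tendsto f atImInfty (𝓝 (c 0)) := by
  have hq : Tendsto (fun τ : ℍ ↦ 𝕢 1 τ) atImInfty (𝓝 0) := qParam_tendsto_atImInfty one_pos
  have hb : IsBoundedAtImInfty fun τ : ℍ ↦ (f τ - c 0) / 𝕢 1 τ := by
    refine isBoundedAtImInfty_of_hasSum_qExpansion (c := fun m ↦ c (m + 1)) one_pos fun τ ↦ ?_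
    have h := ((hasSum_nat_add_iff' 1).mpr (hf τ)).div_const (𝕢 1 τ)
    have hne : 𝕢 1 τ ≠ 0 := Periodic.qParam_ne_zero _
    convert! h using 2 with m
    · simp only [smul_eq_mul]
      rw [pow_succ]
      field_simp
    · simp
  have h0 : Tendsto (fun τ : ℍ ↦ 𝕢 1 τ * ((f τ - c 0) / 𝕢 1 τ)) atImInfty (𝓝 0) := by
    have h1 := hb.mul_isLittleO ((Asymptotics.isLittleO_one_iff ℝ).mpr hq)
    refine ((Asymptotics.isLittleO_one_iff ℝ).mp (h1.congr_right fun _ ↦ ?_)).congr fun τ ↦ ?_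
    · simp
    · simp [mul_comm]
  refine (h0.add_const (c 0)).congr (fun τ ↦ ?_) |>.trans (by simp)
  have hne : 𝕢 1 τ ≠ 0 := Periodic.qParam_ne_zero _
  field_simp
  ring

lemma tendsto_E2_atImInfty : Tendsto E2 atImInfty (𝓝 1) := by
  simpa using tendsto_atImInfty_of_hasSum_qParam
    (c := fun m : ℕ ↦ (if m = 0 then 1 else -24 * (ArithmeticFunction.sigma 1 m) : ℂ))
    (f := E2) fun τ ↦ by
      simpa only [Function.Periodic.qParam, ofReal_one, div_one] using hasSum_qExpansion_E2 (z := τ)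

lemma tendsto_E_atImInfty {k : ℕ} (hk : 3 ≤ k) (hk2 : Even k) :
    Tendsto (E hk) atImInfty (𝓝 1) := by
  rw [← E_qExpansion_coeff_zero hk hk2]
  exact tendsto_atImInfty_of_hasSum_qParam fun τ ↦
    ModularForm.hasSum_qExpansion (E hk) one_pos one_mem_strictPeriods_SL τ

/-- The derivative of a level one modular form vanishes at `i∞`. -/
lemma tendsto_normalizedDerivOfComplex_atImInfty {k : ℤ} (f : ModularForm 𝒮ℒ k) :
    Tendsto (normalizedDerivOfComplex f) atImInfty (𝓝 0) := by
  have han := ModularFormClass.analyticAt_cuspFunction_zero f one_pos one_mem_strictPeriods_SL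
  have hq : Tendsto (fun τ : ℍ ↦ 𝕢 1 τ) atImInfty (𝓝 0) := qParam_tendsto_atImInfty one_pos
  have hd : ∀ τ : ℍ, normalizedDerivOfComplex f τ =
      𝕢 1 τ * deriv (cuspFunction 1 f) (𝕢 1 τ) := by
    intro τ
    have h1 : f ∘ ofComplex =ᶠ[𝓝 (τ : ℂ)] cuspFunction 1 f ∘ 𝕢 1 := by
      filter_upwards [isOpen_upperHalfPlaneSet.mem_nhds τ.im_pos] with w hw
      have := SlashInvariantFormClass.eq_cuspFunction f (⟨w, hw⟩ : ℍ) one_mem_strictPeriods_SL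
        one_ne_zero
      simpa [ofComplex_apply_of_im_pos hw] using this.symm
    have hnorm : ‖𝕢 1 τ‖ < 1 := Periodic.norm_qParam_lt_one one_pos τ.im_pos
    have h2 : HasDerivAt (𝕢 1) (𝕢 1 τ * (2 * π * I)) (τ : ℂ) := by
      have : HasDerivAt (fun z : ℂ ↦ 2 * π * I * z / (1:ℝ)) (2 * π * I) (τ : ℂ) := by
        simpa using (hasDerivAt_id (τ : ℂ)).const_mul (2 * π * I)
      exact this.cexp
    have h3 := (ModularFormClass.differentiableAt_cuspFunction f one_pos
      one_mem_strictPeriods_SL hnorm).hasDerivAt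
    rw [normalizedDerivOfComplex, h1.deriv_eq, (h3.comp (τ : ℂ) h2).deriv]
    have : (2 * π * I : ℂ) ≠ 0 := two_pi_I_ne_zero
    field_simp
  have h4 := hq.mul (han.deriv.continuousAt.tendsto.comp hq)
  rw [zero_mul] at h4
  exact h4.congr fun τ ↦ (hd τ).symm

/-- Ramanujan's differential equation `D E₆ = (E₂E₆ - E₄²) / 2`. -/
theorem normalizedDerivOfComplex_E₆ (z : ℍ) :
    normalizedDerivOfComplex E₆ z = (E2 z * E₆ z - E₄ z ^ 2) / 2 := by
  let g : ℍ → ℂ := serreDerivative 6 E₆ + (2⁻¹ : ℂ) • (E₄ * E₄ : ℍ → ℂ)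
  have hinv : ∀ γ : SL(2, ℤ), g ∣[(8 : ℤ)] γ = g := by
    intro γ
    have h4 : (E₄ : ℍ → ℂ) ∣[(4 : ℤ)] γ = E₄ := E₄.slash_action_eq' _ ⟨γ, rfl⟩
    have h6 : (E₆ : ℍ → ℂ) ∣[(6 : ℤ)] γ = E₆ := E₆.slash_action_eq' _ ⟨γ, rfl⟩
    have hs := serreDerivative_slash_invariant (ModularFormClass.holo E₆) h6
    have hm := mul_slash_SL2 4 4 γ E₄ E₄
    rw [h4] at hm
    norm_num only at hs hm
    simp only [g, SlashAction.add_slash, SL_smul_slash]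
    rw [hs, hm]
  have hlim : IsZeroAtImInfty g := by
    have h := ((tendsto_normalizedDerivOfComplex_atImInfty E₆).sub
      ((tendsto_E2_atImInfty.const_mul (6 * 12⁻¹)).mul
        (tendsto_E_atImInfty (k := 6) (by norm_num) (by decide)))).add
      (((tendsto_E_atImInfty (k := 4) (by norm_num) (by decide)).mul
        (tendsto_E_atImInfty (k := 4) (by norm_num) (by decide))).const_mul 2⁻¹)
    norm_num at h
    refine h.congr fun τ ↦ ?_
    simp [g]
    norm_num
  let G : CuspForm 𝒮ℒ 8 :=
    { toFun := g
      slash_action_eq' := by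
        rintro _ ⟨γ, rfl⟩
        exact hinv γ
      holo' := (serreDerivative_mdifferentiable 6 (ModularFormClass.holo E₆)).add
        (((ModularFormClass.holo E₄).mul (ModularFormClass.holo E₄)).const_smul _)
      zero_at_cusps' := by
        intro c hc
        rw [Subgroup.IsArithmetic.isCusp_iff_isCusp_SL2Z] at hc
        rw [OnePoint.isZeroAt_iff_forall_SL2Z hc]
        intro γ _
        rw [hinv γ]
        exact hlim }
  have hG : G = 0 := rank_zero_iff_forall_zero.mp
    (CuspForm.rank_eq_zero_of_weight_lt_twelve (by norm_num)) G
  have hz : g z = 0 := by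
    change G z = 0
    rw [hG]
    rfl
  simp only [g, Pi.add_apply, serreDerivative_apply, Pi.smul_apply, Pi.mul_apply, smul_eq_mul] at hz
  linear_combination hz
end Modular

section ImaginaryAxis
open UpperHalfPlane hiding I
open Complex hiding eta
open Filter Topology Function ModularForm EisensteinSeries Derivative Set
open scoped Manifold MatrixGroups

/-- The Dedekind eta function on the imaginary axis, as a real function. -/
noncomputable def etaAxis (t : ℝ) : ℝ := Real.exp (-π * t / 12) * eulerF (Real.exp (-2 * π * t))

lemma I_mul_mem_upperHalfPlaneSet {t : ℝ} (ht : 0 < t) : I * (t : ℂ) ∈ upperHalfPlaneSet := by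
  simpa [upperHalfPlaneSet] using ht

lemma ofReal_eulerF {q : ℝ} (hq : |q| < 1) :
    (eulerF q : ℂ) = ∏' n : ℕ, (1 - (q : ℂ) ^ (n + 1)) := by
  have hm : Multipliable fun n : ℕ ↦ 1 - q ^ (n + 1) := by
    refine multipliable_one_add_of_summable (f := fun n ↦ -q ^ (n + 1)) ?_
    simpa using (summable_nat_add_iff 1).mpr (summable_geometric_of_lt_one (abs_nonneg q) hq)
  have h := hm.map_tprod (Complex.ofRealHom) Complex.continuous_ofReal
  simpa [eulerF] using h

lemma eta_I_mul {t : ℝ} (ht : 0 < t) : η (I * t) = etaAxis t := by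
  have hq : |Real.exp (-2 * π * t)| < 1 := by
    rw [Real.abs_exp, Real.exp_lt_one_iff]
    nlinarith [mul_pos pi_pos ht]
  have h1 : 2 * π * I * (I * t) = ((-2 * π * t : ℝ) : ℂ) := by
    push_cast
    linear_combination (2 * π * t) * I_sq
  rw [etaAxis, ofReal_mul, ofReal_eulerF hq, eta]
  congr 1
  · rw [Periodic.qParam, h1, ofReal_exp]
    congr 1
    push_cast
    ring
  · simp only [eta_q_eq_pow, h1, ofReal_exp]

lemma etaAxis_ne_zero {t : ℝ} (ht : 0 < t) : etaAxis t ≠ 0 := by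
  have h := eta_ne_zero (I_mul_mem_upperHalfPlaneSet ht)
  rw [eta_I_mul ht] at h
  exact_mod_cast h

lemma exists_E_I_mul_eq_ofReal {k : ℕ} (hk : 3 ≤ k) (hk2 : Even k) {t : ℝ} (ht : 0 < t) :
    ∃ r : ℝ, E hk ⟨I * t, I_mul_mem_upperHalfPlaneSet ht⟩ = r := by
  refine ⟨1 - (2 * k / bernoulli k) * ∑' n : ℕ+, (ArithmeticFunction.sigma (k - 1) n : ℝ) *
    Real.exp (-2 * π * t) ^ (n : ℤ), ?_⟩
  have h1 : 2 * π * I * (I * t) = ((-2 * π * t : ℝ) : ℂ) := by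
    push_cast
    linear_combination (2 * π * t) * I_sq
  rw [q_expansion_bernoulli hk hk2, UpperHalfPlane.coe_mk, h1]
  push_cast
  rfl

/-- `E₆ / η¹²` on the imaginary axis, as a real function. -/
noncomputable def sexticAxis (t : ℝ) : ℝ :=
  (E₆ (ofComplex (I * t)) / η (I * t) ^ 12).re

lemma exists_sexticAxis_eq {t : ℝ} (ht : 0 < t) :
    ∃ x y : ℝ, E₄ ⟨I * t, I_mul_mem_upperHalfPlaneSet ht⟩ = x ∧
      E₆ ⟨I * t, I_mul_mem_upperHalfPlaneSet ht⟩ = y ∧ sexticAxis t = y / etaAxis t ^ 12 ∧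
      x ^ 3 = y ^ 2 + 1728 * etaAxis t ^ 24 := by
  obtain ⟨x, hx⟩ := exists_E_I_mul_eq_ofReal (k := 4) (by norm_num) (by decide) ht
  obtain ⟨y, hy⟩ := exists_E_I_mul_eq_ofReal (k := 6) (by norm_num) (by decide) ht
  refine ⟨x, y, hx, hy, ?_, ?_⟩
  · rw [sexticAxis, ofComplex_apply_of_im_pos (I_mul_mem_upperHalfPlaneSet ht), hy, eta_I_mul ht]
    norm_cast
  · have h := discriminant_eq_E₄_cube_sub_E₆_sq ⟨I * t, I_mul_mem_upperHalfPlaneSet ht⟩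
    rw [discriminant, hx, hy, UpperHalfPlane.coe_mk, eta_I_mul ht] at h
    have h2 : etaAxis t ^ 24 = (x ^ 3 - y ^ 2) / 1728 := by exact_mod_cast h
    linear_combination -1728 * h2

lemma hasDerivAt_sexticAxis {t : ℝ} (ht : 0 < t) :
    HasDerivAt sexticAxis ((sexticAxis t ^ 2 + 1728) ^ (2 / 3 : ℝ) * (π * etaAxis t ^ 4)) t := by
  have hmem := I_mul_mem_upperHalfPlaneSet ht
  set z : ℍ := ⟨I * t, hmem⟩
  obtain ⟨x, y, hx, hy, hY, hxy⟩ := exists_sexticAxis_eq ht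
  have hη := etaAxis_ne_zero ht
  have hI : HasDerivAt (fun w : ℂ ↦ I * w) I (t : ℂ) := by
    simpa using (hasDerivAt_id (t : ℂ)).const_mul I
  have hE : HasDerivAt ((E₆ : ℍ → ℂ) ∘ ofComplex) (2 * π * I * ((E2 z * E₆ z - E₄ z ^ 2) / 2))
      (I * t) := by
    have hd : DifferentiableAt ℂ ((E₆ : ℍ → ℂ) ∘ ofComplex) (z : ℂ) :=
      UpperHalfPlane.mdifferentiableAt_iff.mp (ModularFormClass.holo E₆ z)
    refine hd.hasDerivAt.congr_deriv ?_
    rw [← normalizedDerivOfComplex_E₆, normalizedDerivOfComplex,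
      mul_inv_cancel_left₀ two_pi_I_ne_zero]
  have he : HasDerivAt η (η (I * t) * (π * I / 12 * E2 z)) (I * t) := by
    refine (differentiableAt_eta_of_mem_upperHalfPlaneSet hmem).hasDerivAt.congr_deriv ?_
    rw [← logDeriv_eta_eq_E2 z, logDeriv_apply, mul_div_cancel₀ _ (eta_ne_zero hmem)]
  have h := ((hE.comp (t : ℂ) hI).div ((he.comp (t : ℂ) hI).pow 12)
    (pow_ne_zero 12 (eta_ne_zero hmem))).real_of_complex
  refine h.congr_deriv ?_
  have hpow : (sexticAxis t ^ 2 + 1728) ^ (2 / 3 : ℝ) = (x / etaAxis t ^ 8) ^ 2 := by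
    have h24 : 0 < etaAxis t ^ 24 := Even.pow_pos (by decide) hη
    have hx0 : 0 < x := (Odd.pow_pos_iff (by decide : Odd 3)).mp (by rw [hxy]; positivity)
    have h8 : 0 < etaAxis t ^ 8 := Even.pow_pos (by decide) hη
    have hcube : sexticAxis t ^ 2 + 1728 = (x / etaAxis t ^ 8) ^ (3 : ℝ) := by
      rw [hY, show (3 : ℝ) = (3 : ℕ) by norm_num, rpow_natCast, div_pow x, hxy]
      field_simp
    rw [hcube, ← rpow_mul (by positivity), ← rpow_natCast _ 2]
    norm_num
  have hE' : ((E₆ : ℍ → ℂ) ∘ ofComplex) (I * t) = y := by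
    rw [comp_apply, ofComplex_apply_of_im_pos hmem, hy]
  rw [hpow, ← ofReal_re ((x / etaAxis t ^ 8) ^ 2 * (π * etaAxis t ^ 4))]
  congr 1
  have hηc : (etaAxis t : ℂ) ≠ 0 := ofReal_ne_zero.mpr hη
  simp only [comp_apply, Pi.pow_apply] at hE' ⊢
  rw [hE', eta_I_mul ht, hx, hy]
  push_cast
  field_simp
  linear_combination -(x : ℂ) ^ 2 * I_sq

lemma tendsto_sexticAxis_atTop : Tendsto sexticAxis atTop atTop := by
  have hI : Tendsto (fun t : ℝ ↦ I * (t : ℂ)) atTop (comap Complex.im atTop) := by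
    rw [tendsto_comap_iff]
    exact tendsto_id.congr fun t ↦ by simp
  have hz := tendsto_comap_im_ofComplex.comp hI
  have h6 : Tendsto (fun t : ℝ ↦ (E₆ (ofComplex (I * t))).re) atTop (𝓝 1) := by
    have h := (tendsto_E_atImInfty (k := 6) (by norm_num) (by decide)).comp hz
    exact Complex.one_re ▸ (Complex.continuous_re.tendsto _).comp h
  have h24 : Tendsto (fun t ↦ etaAxis t ^ 24) atTop (𝓝 0) := by
    have h := (Complex.continuous_re.tendsto _).comp (discriminant_isZeroAtImInfty.comp hz)
    rw [Complex.zero_re] at h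
    refine h.congr' ?_
    filter_upwards [eventually_gt_atTop 0] with t ht
    simp only [comp_apply, discriminant,
      ofComplex_apply_of_im_pos (I_mul_mem_upperHalfPlaneSet ht), UpperHalfPlane.coe_mk,
      eta_I_mul ht]
    norm_cast
  have h12 : Tendsto (fun t ↦ etaAxis t ^ 12) atTop (𝓝[>] 0) := by
    refine tendsto_nhdsWithin_iff.mpr ⟨?_, ?_⟩
    · have h := (continuous_sqrt.tendsto 0).comp h24
      rw [Real.sqrt_zero] at h
      refine h.congr fun t ↦ ?_
      rw [comp_apply, show etaAxis t ^ 24 = (etaAxis t ^ 12) ^ 2 by ring,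
        sqrt_sq (Even.pow_nonneg (by decide) _)]
    · filter_upwards [eventually_gt_atTop 0] with t ht
      exact Even.pow_pos (by decide) (etaAxis_ne_zero ht)
  refine (h6.pos_mul_atTop one_pos h12.inv_tendsto_nhdsGT_zero).congr' ?_
  filter_upwards [eventually_gt_atTop 0] with t ht
  obtain ⟨x, y, hx, hy, hY, hxy⟩ := exists_sexticAxis_eq ht
  rw [ofComplex_apply_of_im_pos (I_mul_mem_upperHalfPlaneSet ht), hy, hY, ofReal_re,
    Pi.inv_apply, div_eq_mul_inv]

lemma sexticAxis_inv {t : ℝ} (ht : 0 < t) : sexticAxis t⁻¹ = -sexticAxis t := by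
  have hmem := I_mul_mem_upperHalfPlaneSet ht
  have hmem' := I_mul_mem_upperHalfPlaneSet (inv_pos.mpr ht)
  have hI0 : I * (t : ℂ) ≠ 0 := mul_ne_zero I_ne_zero (ofReal_ne_zero.mpr ht.ne')
  have hinv : I * ((t⁻¹ : ℝ) : ℂ) = -1 / (I * t) := by
    have := ofReal_ne_zero.mpr ht.ne'
    push_cast
    field_simp
    linear_combination I_sq
  have hsqrt : ∀ z : ℂ, z ≠ 0 → sqrt z ^ 12 = z ^ 6 := fun z hz ↦ by
    rw [sqrt_eq_exp hz, ← Complex.exp_nat_mul]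
    conv_rhs => rw [← Complex.exp_log hz, ← Complex.exp_nat_mul]
    congr 1
    push_cast
    ring
  have hη : η (I * ((t⁻¹ : ℝ) : ℂ)) ^ 12 = t ^ 6 * η (I * t) ^ 12 := by
    have h := eta_comp_eq_csqrt_I_inv hmem
    simp only [comp_apply, Pi.smul_apply, Pi.mul_apply, smul_eq_mul] at h
    rw [hinv, h, mul_pow, mul_pow, inv_pow, hsqrt _ hI0, hsqrt _ I_ne_zero, mul_pow]
    have : I ^ 6 ≠ 0 := pow_ne_zero 6 I_ne_zero
    field_simp
  have hE : E₆ ⟨I * ((t⁻¹ : ℝ) : ℂ), hmem'⟩ = -(t : ℂ) ^ 6 * E₆ ⟨I * t, hmem⟩ := by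
    have h6 : (E₆ : ℍ → ℂ) ∣[(6 : ℤ)] ModularGroup.S = E₆ := E₆.slash_action_eq' _ ⟨_, rfl⟩
    have h := congrFun h6 ⟨I * t, hmem⟩
    rw [SL_slash_apply, ModularGroup.denom_S, modular_S_smul] at h
    have hz : UpperHalfPlane.mk _ (UpperHalfPlane.im_inv_neg_coe_pos ⟨I * t, hmem⟩) =
        ⟨I * ((t⁻¹ : ℝ) : ℂ), hmem'⟩ := by
      ext1
      change (-(I * (t : ℂ)))⁻¹ = I * ((t⁻¹ : ℝ) : ℂ)
      rw [hinv, inv_neg, neg_div, one_div]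
    rw [hz, UpperHalfPlane.coe_mk, zpow_neg, ← div_eq_mul_inv,
      div_eq_iff (zpow_ne_zero _ hI0)] at h
    have hpow : (I * (t : ℂ)) ^ (6 : ℤ) = -(t : ℂ) ^ 6 := by
      rw [← Nat.cast_ofNat (n := 6), zpow_natCast, mul_pow, show 6 = 2 * 3 by rfl, pow_mul, I_sq]
      ring
    rw [h, hpow]
    ring
  rw [sexticAxis, sexticAxis, ofComplex_apply_of_im_pos hmem, ofComplex_apply_of_im_pos hmem',
    hη, hE, ← neg_re]
  have := ofReal_ne_zero.mpr ht.ne'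
  have := eta_ne_zero hmem
  congr 1
  field_simp

lemma tendsto_sexticAxis_zero : Tendsto sexticAxis (𝓝[>] 0) atBot := by
  have h := tendsto_neg_atTop_atBot.comp (tendsto_sexticAxis_atTop.comp tendsto_inv_nhdsGT_zero)
  refine h.congr' ?_
  filter_upwards [self_mem_nhdsWithin] with t ht
  simp [sexticAxis_inv (mem_Ioi.mp ht)]

end ImaginaryAxis

section EulerIntegral
open Set Filter Topology

lemma integrableOn_beta {α β : ℝ} (hα : 0 < α) (hβ : 0 < β) :
    IntegrableOn (fun x : ℝ ↦ x ^ (α - 1) * (1 - x) ^ (β - 1)) (Ioo 0 1) := by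
  have h := Complex.betaIntegral_convergent (u := α) (v := β) (by simpa) (by simpa)
  rw [intervalIntegrable_iff_integrableOn_Ioo_of_le zero_le_one] at h
  refine IntegrableOn.congr_fun h.re (fun x hx ↦ ?_) measurableSet_Ioo
  have h1 : 0 ≤ 1 - x := by linarith [hx.2]
  simp only [RCLike.re_to_complex]
  rw [← Complex.ofReal_re (x ^ (α - 1) * (1 - x) ^ (β - 1)), Complex.ofReal_mul,
    Complex.ofReal_cpow hx.1.le, Complex.ofReal_cpow h1]
  norm_num

lemma integral_beta {α β : ℝ} (hα : 0 < α) (hβ : 0 < β) :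
    ∫ x in Ioo (0 : ℝ) 1, x ^ (α - 1) * (1 - x) ^ (β - 1) =
      Gamma α * Gamma β / Gamma (α + β) := by
  have h : Complex.betaIntegral α β =
      ((∫ x in Ioo (0 : ℝ) 1, x ^ (α - 1) * (1 - x) ^ (β - 1) : ℝ) : ℂ) := by
    rw [Complex.betaIntegral, intervalIntegral.integral_of_le zero_le_one,
      integral_Ioc_eq_integral_Ioo, ← integral_complex_ofReal]
    refine setIntegral_congr_fun measurableSet_Ioo fun x hx ↦ ?_
    have h1 : 0 ≤ 1 - x := by linarith [hx.2]
    simp only [Complex.ofReal_mul]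
    rw [Complex.ofReal_cpow hx.1.le, Complex.ofReal_cpow h1]
    norm_num
  rw [Complex.betaIntegral_eq_Gamma_mul_div _ _ (by simpa) (by simpa), ← Complex.ofReal_add,
    Complex.Gamma_ofReal, Complex.Gamma_ofReal, Complex.Gamma_ofReal] at h
  exact_mod_cast h.symm

lemma Gamma_add_nat {s : ℝ} (hs : 0 < s) (n : ℕ) :
    Gamma (s + n) = (ascPochhammer ℝ n).eval s * Gamma s := by
  induction n with
  | zero => simp
  | succ n ih =>
    rw [Nat.cast_succ, ← add_assoc, Gamma_add_one (by positivity), ih, ascPochhammer_succ_eval]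
    ring

lemma hasSum_one_add_rpow_neg (s : ℝ) {x : ℝ} (hx : |x| < 1) :
    HasSum (fun n : ℕ ↦ (ascPochhammer ℝ n).eval s / n.factorial * (-x) ^ n)
      ((1 + x) ^ (-s)) := by
  have h := (one_div_one_sub_rpow_hasFPowerSeriesOnBall_zero s).hasSum (y := -x) (by
    simpa [enorm_eq_nnnorm, ← NNReal.coe_lt_one] using hx)
  have h1 : 0 < 1 + x := by linarith [(abs_lt.mp hx).1]
  simp only [zero_add, sub_neg_eq_add, one_div, ← rpow_neg h1.le] at h
  convert! h using 1
  ext n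
  have h2 := Ring.factorial_nsmul_multichoose_eq_ascPochhammer s n
  rw [Ring.multichoose_eq, nsmul_eq_mul, Polynomial.ascPochhammer_smeval_eq_eval] at h2
  have h3 : (n.factorial : ℝ) ≠ 0 := by positivity
  rw [FormalMultilinearSeries.ofScalars_apply_eq, ← h2]
  field_simp
  simp

lemma ascPochhammer_eval_le_factorial {b : ℝ} (hb : 0 < b) (hb1 : b < 1) (n : ℕ) :
    (ascPochhammer ℝ n).eval b ≤ n.factorial := by
  induction n with
  | zero => simp
  | succ n ih =>
    rw [ascPochhammer_succ_eval, Nat.factorial_succ, mul_comm]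
    push_cast
    have := (ascPochhammer_pos n b hb).le
    gcongr ?_ * ?_
    linarith

/-- Euler's integral for `₂F₁(s, b; 1; -c)`. -/
theorem integral_eq_hyp2F1 {s b c : ℝ} (hs : 0 < s) (hb : 0 < b) (hb1 : b < 1) (hc : 0 ≤ c)
    (hc1 : c < 1) :
    ∫ u in Ioo (0 : ℝ) 1, u ^ (b - 1) * (1 - u) ^ (-b) * (1 + c * u) ^ (-s) =
      Gamma b * Gamma (1 - b) * hyp2F1 s b 1 (-c) := by
  let A : ℕ → ℝ := fun n ↦ (ascPochhammer ℝ n).eval s / n.factorial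
  let B : ℕ → ℝ := fun n ↦ (ascPochhammer ℝ n).eval b / n.factorial * (Gamma b * Gamma (1 - b))
  let F : ℕ → ℝ → ℝ := fun n u ↦ A n * (-c) ^ n * (u ^ (b + n - 1) * (1 - u) ^ (1 - b - 1))
  have hA : ∀ n, 0 < A n := fun n ↦ div_pos (ascPochhammer_pos n s hs) (by positivity)
  have hG : 0 < Gamma b * Gamma (1 - b) :=
    mul_pos (Gamma_pos_of_pos hb) (Gamma_pos_of_pos (by linarith))
  have hB : ∀ n : ℕ, ∫ u in Ioo (0 : ℝ) 1, u ^ (b + n - 1) * (1 - u) ^ (1 - b - 1) = B n := by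
    intro n
    rw [integral_beta (by positivity) (by linarith), Gamma_add_nat hb,
      show b + n + (1 - b) = n + 1 by ring, Gamma_nat_eq_factorial]
    ring
  have hint : ∀ n, Integrable (F n) (volume.restrict (Ioo 0 1)) := fun n ↦
    (integrableOn_beta (by positivity) (by linarith)).const_mul _
  have hnorm : ∀ n, ∫ u in Ioo (0 : ℝ) 1, ‖F n u‖ = A n * c ^ n * B n := by
    intro n
    rw [← hB, ← integral_const_mul]
    refine setIntegral_congr_fun measurableSet_Ioo fun u hu ↦ ?_
    have h1 : 0 < 1 - u := by linarith [hu.2]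
    have h2 : 0 < u := hu.1
    simp only [F, norm_mul, norm_pow, norm_neg, Real.norm_eq_abs, abs_of_nonneg hc,
      abs_of_pos (hA n), abs_of_pos (rpow_pos_of_pos h1 _), abs_of_pos (rpow_pos_of_pos h2 _)]
  have hsum : Summable fun n ↦ ∫ u in Ioo (0 : ℝ) 1, ‖F n u‖ := by
    have h := (hasSum_one_add_rpow_neg s (x := -c) (by rwa [abs_neg, abs_of_nonneg hc])).summable
    rw [neg_neg] at h
    refine Summable.of_nonneg_of_le (fun n ↦ integral_nonneg fun u ↦ norm_nonneg _) (fun n ↦ ?_)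
      (h.mul_right (Gamma b * Gamma (1 - b)))
    rw [hnorm]
    have : B n ≤ Gamma b * Gamma (1 - b) := by
      refine mul_le_of_le_one_left hG.le ?_
      rw [div_le_one (by positivity)]
      exact ascPochhammer_eval_le_factorial hb hb1 n
    have := hA n
    gcongr
  have h := hasSum_integral_of_summable_integral_norm hint hsum
  have hF : ∫ u in Ioo (0 : ℝ) 1, ∑' n, F n u =
      ∫ u in Ioo (0 : ℝ) 1, u ^ (b - 1) * (1 - u) ^ (-b) * (1 + c * u) ^ (-s) := by
    refine setIntegral_congr_fun measurableSet_Ioo fun u hu ↦ ?_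
    have hcu : |c * u| < 1 := by
      rw [abs_of_nonneg (mul_nonneg hc hu.1.le)]
      nlinarith [hu.1, hu.2]
    have h1 := (hasSum_one_add_rpow_neg s hcu).mul_left (u ^ (b - 1) * (1 - u) ^ (-b))
    rw [← h1.tsum_eq]
    refine tsum_congr fun n ↦ ?_
    simp only [F, A]
    rw [show b + n - 1 = (b - 1) + n by ring, rpow_add hu.1, rpow_natCast,
      show 1 - b - 1 = -b by ring, ← neg_mul, mul_pow]
    ring
  rw [hF] at h
  rw [← h.tsum_eq, hyp2F1, ← tsum_mul_left]
  refine tsum_congr fun n ↦ ?_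
  simp only [F]
  rw [integral_const_mul, hB, ascPochhammer_eval_one]
  simp only [A, B]
  ring

end EulerIntegral

section Main
open Set Filter Topology

lemma integral_Ioi_etaAxis :
    π * ∫ t in Ioi (0 : ℝ), etaAxis t ^ 4 = ∫ y : ℝ, (y ^ 2 + 1728) ^ (-(2 / 3) : ℝ) := by
  rw [← integral_const_mul]
  exact integral_Ioi_eq_of_hasDerivAt_sq_add_rpow
    (fun t ht ↦ mul_pos pi_pos (Even.pow_pos (by decide) (etaAxis_ne_zero ht)))
    (fun t ht ↦ hasDerivAt_sexticAxis ht) tendsto_sexticAxis_atTop tendsto_sexticAxis_zero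

lemma integral_eulerF_eq_integral_etaAxis :
    ∫ q in (0 : ℝ)..1, eulerF (q ^ 5) ^ 4 * q ^ (-(1 : ℝ) / 6) =
      2 * π / 5 * ∫ t in Ioi (0 : ℝ), etaAxis t ^ 4 := by
  let φ : ℝ → ℝ := fun t ↦ Real.exp (-(2 * π / 5) * t)
  have hφ : ∀ t, HasDerivAt φ (-(2 * π / 5) * φ t) t := fun t ↦
    (((hasDerivAt_id t).const_mul (-(2 * π / 5))).exp).congr_deriv (by simp [φ, mul_comm])
  have himage : φ '' Ioi 0 = Ioo 0 1 := by
    ext q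
    constructor
    · rintro ⟨t, ht, rfl⟩
      refine ⟨Real.exp_pos _, Real.exp_lt_one_iff.mpr ?_⟩
      have : 0 < 2 * π / 5 * t := mul_pos (by positivity) ht
      linarith
    · rintro ⟨hq0, hq1⟩
      refine ⟨-(Real.log q / (2 * π / 5)), ?_, ?_⟩
      · exact neg_pos.mpr (div_neg_of_neg_of_pos (Real.log_neg hq0 hq1) (by positivity))
      · simp only [φ]
        rw [neg_mul_neg, mul_div_cancel₀ _ (by positivity), Real.exp_log hq0]
  have hinj : InjOn φ (Ioi 0) := fun t _ t' _ h ↦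
    mul_left_cancel₀ (by have := pi_pos; linarith) (Real.exp_injective h)
  rw [intervalIntegral.integral_of_le zero_le_one, integral_Ioc_eq_integral_Ioo, ← himage,
    integral_image_eq_integral_abs_deriv_smul measurableSet_Ioi
      (fun t _ ↦ (hφ t).hasDerivWithinAt) hinj, ← integral_const_mul]
  refine setIntegral_congr_fun measurableSet_Ioi fun t ht ↦ ?_
  have h0 : 0 < φ t := Real.exp_pos _
  have h5 : φ t ^ 5 = Real.exp (-2 * π * t) := by
    rw [← Real.exp_nat_mul]
    congr 1
    push_cast
    ring
  have h6 : φ t * φ t ^ (-(1 : ℝ) / 6) = Real.exp (-π * t / 12) ^ 4 := by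
    rw [← Real.exp_nat_mul, ← Real.exp_mul, ← Real.exp_add]
    congr 1
    push_cast
    ring
  simp only [smul_eq_mul]
  rw [abs_mul, abs_neg, abs_of_pos (by positivity : 0 < 2 * π / 5), abs_of_pos h0, h5, etaAxis,
    mul_pow, ← h6]
  ring

end Main

theorem integral_f5_4 :
    ∫ q in (0:ℝ)..1, eulerF (q ^ 5) ^ 4 * q ^ (-(1 : ℝ) / 6) =
      (1 / (8 * (2 : ℝ) ^ ((1 : ℝ) / 6))) * π * (Real.sqrt 5 - 1) ^ ((25 : ℝ) / 6) *
        hyp2F1 (5 / 6) (5 / 6) 1 ((-123 + 55 * Real.sqrt 5) / 2) := by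
  have h5 : √(5 : ℝ) ^ 2 = 5 := sq_sqrt (by norm_num)
  have h1 : 1 < √(5 : ℝ) := by
    rw [lt_sqrt (by norm_num)]
    norm_num
  have hw : 0 < √(5 : ℝ) - 1 := by linarith
  obtain ⟨a, ha⟩ : ∃ a, a = (5 * √(5 : ℝ) - 11) / 2 := ⟨_, rfl⟩
  have ha2 : a ^ 2 + 11 * a = 1 := by rw [ha]; linear_combination 25 / 4 * h5
  have ha5 : a = ((√5 - 1) / 2) ^ 5 := by
    rw [ha]
    linear_combination (-(√5 ^ 3) + 5 * √5 ^ 2 - 15 * √5 + 35) / 32 * h5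
  have ha0 : 0 < a := by rw [ha5]; positivity
  have hint := integral_eq_hyp2F1 (s := 5 / 6) (b := 5 / 6) (c := a ^ 2) (by norm_num)
    (by norm_num) (by norm_num) (by positivity) (by nlinarith)
  have hGamma : Gamma (5 / 6) * Gamma (1 - 5 / 6) = 2 * π := by
    rw [Gamma_mul_Gamma_one_sub, show π * (5 / 6) = π - π / 6 by ring, sin_pi_sub, sin_pi_div_six]
    ring
  have hz : -a ^ 2 = (-123 + 55 * √5) / 2 := by rw [ha]; linear_combination -25 / 4 * h5
  rw [hGamma, hz, show (5 / 6 - 1 : ℝ) = -(1 / 6) by norm_num] at hint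
  have hpow : a ^ (5 / 6 : ℝ) = (√5 - 1) ^ (25 / 6 : ℝ) / (16 * 2 ^ (1 / 6 : ℝ)) := by
    rw [ha5, ← rpow_natCast, ← rpow_mul (by positivity), div_rpow hw.le (by norm_num)]
    congr 1
    · norm_num
    · rw [show ((5 : ℕ) : ℝ) * (5 / 6) = (4 : ℕ) + 1 / 6 by norm_num, rpow_add (by norm_num),
        rpow_natCast]
      norm_num
  have hquintic := integral_Ioi_quintic_eq_integral_Ioo ha0 ha2
  rw [integral_Ioi_quintic, hint, hpow] at hquintic
  rw [integral_eulerF_eq_integral_etaAxis, show ∀ x : ℝ, 2 * π / 5 * x = 2 / 5 * (π * x) from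
    fun x ↦ by ring, integral_Ioi_etaAxis, hquintic]
  ring
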